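/- Let n ≥ 1, let 0 ≤ s ≤ n, let f : ℝⁿ → ℂ be C^∞, and let A_1, …, A_s be convex bodies in ℝⁿ. Define φ(K) := ∂^s/∂λ_1⋯∂λ_s |_{λ=0} ∫_{K + λ_1 A_1 + ⋯ + λ_s A_s} f(y) dy (the mixed one-sided partial derivative at λ = 0, which exists since the integral is a smooth function of λ ∈ ℝ_{≥0}^s). Then for every convex body K and every x ∈ ℝⁿ, the function u(t) := φ(tK + x) is C^∞ on [0,1] and u^{(k)}(0) = 0 for every k < n − s. -/

import Mathlib

open scoped Pointwise ContDiff
open MeasureTheory Set Filter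

noncomputable section

/-- Euclidean space `ℝⁿ`. -/
abbrev Euc (n : ℕ) := EuclideanSpace ℝ (Fin n)

/-- The one-point convex body `{x}`. -/
def ptBody {n : ℕ} (x : Euc n) : ConvexBody (Euc n) :=
  ⟨{x}, convex_singleton x, isCompact_singleton, Set.singleton_nonempty x⟩

/-- The convex body `t • K + x`. -/
def scaleTrans {n : ℕ} (t : ℝ) (x : Euc n) (K : ConvexBody (Euc n)) : ConvexBody (Euc n) :=
  t • K + ptBody x

/-- One-sided partial derivative in the `i`-th coordinate: the derivative of
`t ↦ g(λ with i-th coordinate replaced by t)` within `[0, ∞)` (so one-sided at `0`). -/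
def pderivOrth {s : ℕ} {F : Type*} [NormedAddCommGroup F] [NormedSpace ℝ F]
    (g : (Fin s → ℝ) → F) (i : Fin s) : (Fin s → ℝ) → F :=
  fun lam => derivWithin (fun t => g (Function.update lam i t)) (Set.Ici 0) (lam i)

/-- The iterated one-sided mixed partial derivative `∂^s/∂λ₁⋯∂λ_s |_{λ=0}` of a function on
the closed orthant `ℝ_{≥0}^s`. -/
def mixedPartialAtZero {s : ℕ} {F : Type*} [NormedAddCommGroup F] [NormedSpace ℝ F]
    (g : (Fin s → ℝ) → F) : F :=
  (List.foldl pderivOrth g (List.finRange s)) 0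

section ParametricIntegral

universe u

variable {X Y E F : Type*} [MeasurableSpace X] {μ : Measure X}
  [NormedAddCommGroup Y] [NormedSpace ℝ Y] [ProperSpace Y]
  [NormedAddCommGroup E] [NormedSpace ℝ E] [ProperSpace E]
  [NormedAddCommGroup F] [NormedSpace ℝ F]

omit [NormedSpace ℝ Y] [NormedSpace ℝ E] [NormedSpace ℝ F] in
theorem exists_bound_on_closedBall_prod {Φ : E × Y → F} (hΦ : Continuous Φ) (l₀ : E) (r R : ℝ) :
    ∃ C, ∀ l ∈ Metric.closedBall l₀ r, ∀ y, ‖y‖ ≤ R → ‖Φ (l, y)‖ ≤ C := by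
  obtain ⟨C, hC⟩ := ((isCompact_closedBall l₀ r).prod (isCompact_closedBall (0 : Y) R)
    ).exists_bound_of_continuousOn hΦ.continuousOn
  exact ⟨C, fun l hl y hy => hC (l, y) ⟨hl, by simpa using hy⟩⟩

omit [NormedSpace ℝ Y] [NormedSpace ℝ E] in
theorem integrable_smul_comp_param {g : X → ℝ} (hg : Integrable g μ) {k : X → Y}
    (hk : AEStronglyMeasurable k μ) {R : ℝ} (hR : ∀ x, ‖k x‖ ≤ R) {Φ : E × Y → F}
    (hΦ : Continuous Φ) (l : E) : Integrable (fun x => g x • Φ (l, k x)) μ := by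
  obtain ⟨C, hC⟩ := exists_bound_on_closedBall_prod hΦ l 0 R
  exact hg.smul_bdd C
    ((hΦ.comp (Continuous.prodMk_right l)).comp_aestronglyMeasurable hk)
    (ae_of_all _ fun x => hC l (by simp) _ (hR x))

omit [NormedSpace ℝ Y] in
/-- Differentiation under the integral sign for integrands of the form `g x • Φ (l, k x)` with
`g` integrable and `k` bounded. -/
theorem hasFDerivAt_integral_smul_comp_param {g : X → ℝ} (hg : Integrable g μ) {k : X → Y}
    (hk : AEStronglyMeasurable k μ) {R : ℝ} (hR : ∀ x, ‖k x‖ ≤ R) {Φ : E × Y → F}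
    {Φ' : E × Y → E →L[ℝ] F} (hΦ : Continuous Φ) (hΦ' : Continuous Φ')
    (hd : ∀ l y, HasFDerivAt (fun l => Φ (l, y)) (Φ' (l, y)) l) (l₀ : E) :
    HasFDerivAt (fun l => ∫ x, g x • Φ (l, k x) ∂μ) (∫ x, g x • Φ' (l₀, k x) ∂μ) l₀ := by
  obtain ⟨C, hC⟩ := exists_bound_on_closedBall_prod hΦ' l₀ 1 R
  refine hasFDerivAt_integral_of_dominated_of_fderiv_le (s := Metric.closedBall l₀ 1)
    (F' := fun l x => g x • Φ' (l, k x)) (bound := fun x => ‖g x‖ * C)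
    (Metric.closedBall_mem_nhds _ one_pos)
    (Eventually.of_forall fun l => (integrable_smul_comp_param hg hk hR hΦ l).1)
    (integrable_smul_comp_param hg hk hR hΦ l₀)
    (integrable_smul_comp_param hg hk hR hΦ' l₀).1 ?_ (hg.norm.mul_const C) ?_
  · refine ae_of_all _ fun x l hl => ?_
    rw [norm_smul]
    exact mul_le_mul_of_nonneg_left (hC l hl _ (hR x)) (norm_nonneg _)
  · exact ae_of_all _ fun x l _ => (hd l (k x)).const_smul (g x)

theorem contDiff_integral_smul_comp_param {E F : Type u} [NormedAddCommGroup E] [NormedSpace ℝ E]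
    [ProperSpace E] [NormedAddCommGroup F] [NormedSpace ℝ F] {g : X → ℝ} (hg : Integrable g μ)
    {k : X → Y} (hk : AEStronglyMeasurable k μ) {R : ℝ} (hR : ∀ x, ‖k x‖ ≤ R) {Φ : E × Y → F}
    (hΦ : ContDiff ℝ ∞ Φ) : ContDiff ℝ ∞ (fun l => ∫ x, g x • Φ (l, k x) ∂μ) := by
  have key : ∀ m : ℕ, ∀ (G : Type u) [NormedAddCommGroup G] [NormedSpace ℝ G] (Ψ : E × Y → G),
      ContDiff ℝ ∞ Ψ → ContDiff ℝ m (fun l => ∫ x, g x • Ψ (l, k x) ∂μ) := by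
    intro m
    induction m with
    | zero =>
      intro G _ _ Ψ hΨ
      have hΨ' : Continuous fun p : E × Y => (fderiv ℝ Ψ p).comp (ContinuousLinearMap.inl ℝ E Y) :=
        (hΨ.continuous_fderiv (by simp)).clm_comp continuous_const
      refine contDiff_zero.2 (continuous_iff_continuousAt.2 fun l => ?_)
      exact (hasFDerivAt_integral_smul_comp_param hg hk hR hΨ.continuous hΨ' (fun l y =>
        ((hΨ.differentiable (by simp) (l, y)).hasFDerivAt).comp l
          (hasFDerivAt_prodMk_left l y)) l).continuousAt
    | succ m ih =>
      intro G _ _ Ψ hΨ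
      have hΨ' : ContDiff ℝ ∞
          fun p : E × Y => (fderiv ℝ Ψ p).comp (ContinuousLinearMap.inl ℝ E Y) :=
        (hΨ.fderiv_right (m := ∞) (by simp)).clm_comp contDiff_const
      refine contDiff_succ_iff_hasFDerivAt.2 ⟨_, ih _ _ hΨ', fun l => ?_⟩
      exact hasFDerivAt_integral_smul_comp_param hg hk hR hΨ.continuous hΨ'.continuous
        (fun l y => ((hΨ.differentiable (by simp) (l, y)).hasFDerivAt).comp l
          (hasFDerivAt_prodMk_left l y)) l
  exact contDiff_infty.2 fun m => key m F Φ hΦ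

end ParametricIntegral

section Potential

universe u

variable {E : Type u} [NormedAddCommGroup E] [InnerProductSpace ℝ E] [FiniteDimensional ℝ E]

open ProbabilityTheory

/-- A convex function whose gradient takes values in `A`, whose Hessian degenerates only in
directions orthogonal to `A - A`, and which is asymptotically bounded below by the support function
of `A`. -/
structure GradientPotential (A : Set E) where
  /-- the potential -/
  pot : E → ℝ
  /-- its gradient -/
  grad : E → E
  /-- its Hessian -/
  hess : E → E →L[ℝ] E
  hasFDerivAt_pot : ∀ x, HasFDerivAt pot (innerSL ℝ (grad x)) x
  hasFDerivAt_grad : ∀ x, HasFDerivAt grad (hess x) x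
  grad_mem : ∀ x, grad x ∈ A
  hess_nonneg : ∀ x v, 0 ≤ inner ℝ (hess x v) v
  inner_eq_of_hess_eq_zero : ∀ x v, inner ℝ (hess x v) v = 0 →
    ∀ a ∈ A, ∀ b ∈ A, inner ℝ a v = inner ℝ b v
  le_pot : ∀ δ > 0, ∃ C, ∀ x, ∀ a ∈ A, inner ℝ x a - δ * ‖x‖ - C ≤ pot x

theorem exists_gradientPotential {A : Set E} (hc : Convex ℝ A) (hA : IsCompact A)
    (hne : A.Nonempty) : Nonempty (GradientPotential A) := by
  classical
  have : Nonempty A := hne.to_subtype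
  set a : ℕ → E := fun k => (TopologicalSpace.denseSeq A k : E) with ha
  have haA : ∀ k, a k ∈ A := fun k => Subtype.coe_prop _
  have hdense : ∀ y ∈ A, ∀ ε > 0, ∃ k, dist y (a k) < ε := by
    intro y hy ε hε
    obtain ⟨k, hk⟩ := (TopologicalSpace.denseRange_denseSeq A).exists_dist_lt ⟨y, hy⟩ hε
    exact ⟨k, hk⟩
  obtain ⟨R, hR⟩ : ∃ R, ∀ k, ‖a k‖ ≤ R := by
    obtain ⟨R, hR⟩ := hA.isBounded.exists_norm_le
    exact ⟨R, fun k => hR _ (haA k)⟩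
  set μ : Measure ℕ := poissonMeasure 1 with hμ
  have hw : ∀ k, 0 < μ.real {k} := fun k => poissonMeasure_real_singleton_pos k one_pos
  have hk : AEStronglyMeasurable a μ := (StronglyMeasurable.of_discrete).aestronglyMeasurable
  have h1 : Integrable (fun _ : ℕ => (1 : ℝ)) μ := integrable_const _
  have int : ∀ {F : Type u} [NormedAddCommGroup F] [NormedSpace ℝ F] {Φ : E × E → F},
      Continuous Φ → ∀ x, Integrable (fun k => Φ (x, a k)) μ := by
    intro F _ _ Φ hΦ x
    simpa using integrable_smul_comp_param h1 hk hR hΦ x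
  have intR : ∀ {Φ : E × E → ℝ}, Continuous Φ → ∀ x, Integrable (fun k => Φ (x, a k)) μ := by
    intro Φ hΦ x
    simpa using integrable_smul_comp_param h1 hk hR hΦ x
  set e : E → ℕ → ℝ := fun x k => Real.exp (inner ℝ x (a k)) with he
  have hepos : ∀ x k, 0 < e x k := fun x k => Real.exp_pos _
  set Z : E → ℝ := fun x => ∫ k, e x k ∂μ with hZ
  set N : E → E := fun x => ∫ k, e x k • a k ∂μ with hN
  set dZ : E → E →L[ℝ] ℝ := fun x => ∫ k, e x k • innerSL ℝ (a k) ∂μ with hdZ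
  set dN : E → E →L[ℝ] E := fun x => ∫ k, e x k • (innerSL ℝ (a k)).smulRight (a k) ∂μ with hdN
  have eint : ∀ x, Integrable (e x) μ := fun x =>
    intR (Φ := fun p => Real.exp (inner ℝ p.1 p.2)) (by fun_prop) x
  have c1 : Continuous fun p : E × E => Real.exp (inner ℝ p.1 p.2) • innerSL ℝ p.2 := by
    fun_prop
  have c2 : Continuous fun p : E × E =>
      Real.exp (inner ℝ p.1 p.2) • (innerSL ℝ p.2).smulRight p.2 := by
    have hexp : Continuous fun p : E × E => Real.exp (inner ℝ p.1 p.2) := by fun_prop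
    exact hexp.smul ((ContinuousLinearMap.smulRightL ℝ E E).continuous₂.comp
      (((innerSL ℝ).continuous.comp continuous_snd).prodMk continuous_snd))
  have dexp : ∀ x y : E, HasFDerivAt (fun x : E => Real.exp (inner ℝ x y))
      (Real.exp (inner ℝ x y) • innerSL ℝ y) x := by
    intro x y
    have : HasFDerivAt (fun x : E => inner ℝ x y) (innerSL ℝ y) x := by
      simpa [real_inner_comm] using (innerSL ℝ y).hasFDerivAt (x := x)
    exact this.exp
  have hZd : ∀ x, HasFDerivAt Z (dZ x) x := by
    intro x
    have := hasFDerivAt_integral_smul_comp_param h1 hk hR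
      (Φ := fun p : E × E => Real.exp (inner ℝ p.1 p.2)) (by fun_prop) c1 dexp x
    simpa using this
  have hNd : ∀ x, HasFDerivAt N (dN x) x := by
    intro x
    have := hasFDerivAt_integral_smul_comp_param h1 hk hR
      (Φ := fun p : E × E => Real.exp (inner ℝ p.1 p.2) • p.2) (by fun_prop) c2
      (fun x y => by
        convert (dexp x y).smul_const y using 1
        ext v; simp [smul_smul]) x
    simpa using this
  have hZpos : ∀ x, 0 < Z x := by
    intro x
    exact integral_exp_pos (eint x)
  have iN : ∀ x, Integrable (fun k => e x k • a k) μ := fun x =>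
    int (Φ := fun p => Real.exp (inner ℝ p.1 p.2) • p.2) (by fun_prop) x
  have iS : ∀ x v, Integrable (fun k => e x k * inner ℝ (a k) v) μ := fun x v =>
    intR (Φ := fun p => Real.exp (inner ℝ p.1 p.2) * inner ℝ p.2 v) (by fun_prop) x
  have iQ : ∀ x v, Integrable (fun k => e x k * inner ℝ (a k) v ^ 2) μ := fun x v =>
    intR (Φ := fun p => Real.exp (inner ℝ p.1 p.2) * inner ℝ p.2 v ^ 2) (by fun_prop) x
  have hNS : ∀ x v, inner ℝ (N x) v = ∫ k, e x k * inner ℝ (a k) v ∂μ := by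
    intro x v
    rw [real_inner_comm, ← integral_inner (iN x)]
    simp [inner_smul_right, real_inner_comm, he]
  have hdZN : ∀ x v, dZ x v = inner ℝ (N x) v := by
    intro x v
    rw [hNS, hdZ, ContinuousLinearMap.integral_apply (int c1 x)]
    simp
    rfl
  have hquad : ∀ x v, inner ℝ (dN x v) v = ∫ k, e x k * inner ℝ (a k) v ^ 2 ∂μ := by
    intro x v
    rw [hdN, ContinuousLinearMap.integral_apply (int c2 x), real_inner_comm, ← integral_inner
      ((int c2 x).apply_continuousLinearMap v)]
    refine integral_congr_ae (ae_of_all _ fun k => ?_)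
    simp [inner_smul_right, real_inner_comm]
    ring
  set T : E → E := fun x => (Z x)⁻¹ • N x with hT
  set dT : E → E →L[ℝ] E := fun x =>
    (Z x)⁻¹ • dN x + (-(Z x ^ 2)⁻¹ • dZ x).smulRight (N x) with hdT
  have hvar : ∀ x v, inner ℝ (dT x v) v =
      (Z x)⁻¹ * ∫ k, e x k * (inner ℝ (a k) v - (Z x)⁻¹ * inner ℝ (N x) v) ^ 2 ∂μ := by
    intro x v
    have hZ0 := (hZpos x).ne'
    set m := (Z x)⁻¹ * inner ℝ (N x) v with hm
    have h2 : ∫ k, e x k * (inner ℝ (a k) v - m) ^ 2 ∂μ =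
        inner ℝ (dN x v) v - 2 * m * inner ℝ (N x) v + m ^ 2 * Z x := by
      have i1 := (iS x v).const_mul (2 * m)
      have i2 := (eint x).const_mul (m ^ 2)
      have h3 : ∫ k, (e x k * inner ℝ (a k) v ^ 2 - 2 * m * (e x k * inner ℝ (a k) v)) ∂μ =
          inner ℝ (dN x v) v - 2 * m * inner ℝ (N x) v := by
        rw [integral_sub (iQ x v) i1, integral_const_mul, hquad, hNS]
      rw [← h3, hZ, ← integral_const_mul, ← integral_add ((iQ x v).sub' i1) i2]
      exact integral_congr_ae (ae_of_all _ fun k => by ring)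
    rw [h2, hdT]
    simp only [add_apply, smul_apply,
      ContinuousLinearMap.smulRight_apply, inner_add_left, inner_smul_left, hdZN, hm]
    simp
    field_simp
    ring
  refine ⟨⟨fun x => Real.log (Z x), T, dT, fun x => ?_, fun x => ?_, fun x => ?_, fun x v => ?_,
    fun x v h => ?_, fun δ hδ => ?_⟩⟩
  · convert (hZd x).log (hZpos x).ne' using 1
    ext v
    simp [hT, hdZN]
  · have := ((hasDerivAt_inv (hZpos x).ne').comp_hasFDerivAt x (hZd x)).smul (hNd x)
    exact this
  · have : T x = ∫ k, a k ∂(μ.tilted (fun k => inner ℝ x (a k))) := by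
      rw [integral_tilted, hT, hN]
      simp only [div_eq_inv_mul, ← smul_smul]
      rw [integral_smul]
    have hprob := isProbabilityMeasure_tilted (eint x)
    rw [this]
    refine hc.integral_mem hA.isClosed (ae_of_all _ haA) ?_
    exact Integrable.of_bound (StronglyMeasurable.of_discrete).aestronglyMeasurable R
      (ae_of_all _ hR)
  · rw [hvar]
    exact mul_nonneg (inv_nonneg.2 (hZpos x).le) (integral_nonneg fun k =>
      mul_nonneg (hepos x k).le (sq_nonneg _))
  · rw [hvar, mul_eq_zero, or_iff_right (inv_ne_zero (hZpos x).ne')] at h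
    set m := (Z x)⁻¹ * inner ℝ (N x) v
    have hm : ∀ k, inner ℝ (a k) v = m := by
      rw [integral_eq_zero_iff_of_nonneg (fun k => mul_nonneg (hepos x k).le (sq_nonneg _))
        (intR (Φ := fun p => Real.exp (inner ℝ p.1 p.2) * (inner ℝ p.2 v - m) ^ 2)
          (by fun_prop) x)] at h
      intro k
      have hk0 : μ {k} ≠ 0 := fun h0 => (hw k).ne' (by simp [Measure.real, h0])
      have := (ae_iff_of_countable.1 h) k hk0
      have := (mul_eq_zero.1 this).resolve_left (hepos x k).ne'
      exact sub_eq_zero.1 (pow_eq_zero_iff (two_ne_zero) |>.1 this)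
    have hm' : ∀ y ∈ A, inner ℝ y v = m := by
      intro y hy
      have hcl : IsClosed {y : E | inner ℝ y v = m} :=
        isClosed_eq (by fun_prop) continuous_const
      refine hcl.closure_subset_iff (s := range a) |>.2 ?_ ?_
      · rintro _ ⟨k, rfl⟩; exact hm k
      · refine Metric.mem_closure_iff.2 fun ε hε => ?_
        obtain ⟨k, hk⟩ := hdense y hy ε hε
        exact ⟨a k, ⟨k, rfl⟩, hk⟩
    intro y hy z hz
    rw [hm' y hy, hm' z hz]
  · have hlow : ∀ x k, inner ℝ x (a k) + Real.log (μ.real {k}) ≤ Real.log (Z x) := by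
      intro x k
      rw [Real.le_log_iff_exp_le (hZpos x), Real.exp_add, Real.exp_log (hw k)]
      calc Real.exp (inner ℝ x (a k)) * μ.real {k} = ∫ j in {k}, e x j ∂μ := by
            rw [integral_singleton]; simp [he, mul_comm]
        _ ≤ Z x := setIntegral_le_integral (eint x) (ae_of_all _ fun k => (hepos x k).le)
    obtain ⟨t, ht⟩ := hA.elim_finite_subcover (fun k => Metric.ball (a k) δ)
      (fun k => Metric.isOpen_ball) (fun y hy => by
        obtain ⟨k, hk⟩ := hdense y hy δ hδ
        exact mem_iUnion.2 ⟨k, hk⟩)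
    refine ⟨∑ k ∈ t, |Real.log (μ.real {k})|, fun x y hy => ?_⟩
    obtain ⟨k, hkt, hky⟩ := mem_iUnion₂.1 (ht hy)
    have h3 := hlow x k
    have h4 : |Real.log (μ.real {k})| ≤ ∑ k ∈ t, |Real.log (μ.real {k})| :=
      Finset.single_le_sum (f := fun k => |Real.log (μ.real {k})|)
        (fun _ _ => abs_nonneg _) hkt
    have h5 := neg_abs_le (Real.log (μ.real {k}))
    have h6 : inner ℝ x y - inner ℝ x (a k) ≤ δ * ‖x‖ := by
      rw [← inner_sub_right]
      refine (real_inner_le_norm _ _).trans ?_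
      rw [mul_comm]
      refine mul_le_mul_of_nonneg_right ?_ (norm_nonneg _)
      rw [← dist_eq_norm]; exact (Metric.mem_ball.1 hky).le
    linarith

end Potential

section MinkowskiCombination

variable {E ι : Type*} [NormedAddCommGroup E] [InnerProductSpace ℝ E] [Fintype ι]

/-- The Minkowski combination `∑ i, l i • A i` of convex bodies. -/
def minkowskiComb (A : ι → ConvexBody E) (l : ι → ℝ) : ConvexBody E := ∑ i, l i • A i

theorem coe_minkowskiComb (A : ι → ConvexBody E) (l : ι → ℝ) :
    (minkowskiComb A l : Set E) = ∑ i, l i • (A i : Set E) := by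
  have h : ∀ s : Finset ι, ((∑ i ∈ s, l i • A i : ConvexBody E) : Set E) =
      ∑ i ∈ s, l i • (A i : Set E) := by
    classical
    intro s
    induction s using Finset.induction_on with
    | empty => rfl
    | insert i s hi ih => rw [Finset.sum_insert hi, Finset.sum_insert hi, ConvexBody.coe_add, ih,
        ConvexBody.coe_smul]
  exact h _

theorem mem_minkowskiComb {A : ι → ConvexBody E} {l : ι → ℝ} {y : E} :
    y ∈ (minkowskiComb A l : Set E) ↔ ∃ a : ι → E, (∀ i, a i ∈ A i) ∧ ∑ i, l i • a i = y := by
  rw [coe_minkowskiComb, Set.mem_fintype_sum]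
  constructor
  · rintro ⟨g, hg, rfl⟩
    choose a ha using fun i => Set.mem_smul_set.1 (hg i)
    exact ⟨a, fun i => (ha i).1, Finset.sum_congr rfl fun i _ => (ha i).2⟩
  · rintro ⟨a, ha, rfl⟩
    exact ⟨fun i => l i • a i, fun i => Set.smul_mem_smul_set (ha i), rfl⟩

theorem minkowskiComb_add (A : ι → ConvexBody E) {l m : ι → ℝ} (hl : 0 ≤ l) (hm : 0 ≤ m) :
    minkowskiComb A (l + m) = minkowskiComb A l + minkowskiComb A m := by
  simp only [minkowskiComb, ← Finset.sum_add_distrib]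
  refine Finset.sum_congr rfl fun i _ => ?_
  exact ConvexBody.ext ((A i).convex.add_smul (hl i) (hm i))

theorem minkowskiComb_smul (A : ι → ConvexBody E) (c : ℝ) (l : ι → ℝ) :
    minkowskiComb A (c • l) = c • minkowskiComb A l := by
  simp [minkowskiComb, Finset.smul_sum, mul_smul]

theorem interior_minkowskiComb_nonempty {A : ι → ConvexBody E} {l m : ι → ℝ} (hm : 0 ≤ m)
    {c : ℝ} (hc : 0 < c) (hml : c • m ≤ l) (h : (interior (minkowskiComb A m : Set E)).Nonempty) :
    (interior (minkowskiComb A l : Set E)).Nonempty := by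
  have : l = c • m + (l - c • m) := by abel
  rw [this, minkowskiComb_add A (smul_nonneg hc.le hm) (sub_nonneg.2 hml), minkowskiComb_smul,
    ConvexBody.coe_add, ConvexBody.coe_smul]
  refine Set.Nonempty.mono subset_interior_add_left (Set.Nonempty.add ?_
    (minkowskiComb A (l - c • m)).nonempty)
  rw [interior_smul₀ hc.ne']
  exact h.smul_set

variable {A : ι → ConvexBody E} (P : ∀ i, GradientPotential (A i : Set E))

/-- The linear combination of the gradient maps. -/
def combGrad (l : ι → ℝ) (x : E) : E := ∑ i, l i • (P i).grad x

/-- The linear combination of the Hessians. -/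
def combHess (l : ι → ℝ) (x : E) : E →L[ℝ] E := ∑ i, l i • (P i).hess x

theorem hasFDerivAt_combGrad (l : ι → ℝ) (x : E) :
    HasFDerivAt (combGrad P l) (combHess P l x) x :=
  HasFDerivAt.fun_sum fun i _ => ((P i).hasFDerivAt_grad x).const_smul (l i)

theorem combGrad_mem (l : ι → ℝ) (x : E) : combGrad P l x ∈ (minkowskiComb A l : Set E) :=
  mem_minkowskiComb.2 ⟨fun i => (P i).grad x, fun i => (P i).grad_mem x, rfl⟩

theorem inner_combHess_pos {l : ι → ℝ} (hl : ∀ i, 0 < l i)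
    (hfull : (interior (minkowskiComb A l : Set E)).Nonempty) (x : E) {v : E} (hv : v ≠ 0) :
    0 < inner ℝ (combHess P l x v) v := by
  have hsum : inner ℝ (combHess P l x v) v = ∑ i, l i * inner ℝ ((P i).hess x v) v := by
    simp [combHess, sum_inner, inner_smul_left]
  have hnn : ∀ i ∈ Finset.univ, 0 ≤ l i * inner ℝ ((P i).hess x v) v := fun i _ =>
    mul_nonneg (hl i).le ((P i).hess_nonneg x v)
  rw [hsum]
  refine (Finset.sum_nonneg hnn).lt_of_ne' fun h0 => ?_
  have hz : ∀ i, inner ℝ ((P i).hess x v) v = 0 := fun i =>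
    (mul_eq_zero.1 ((Finset.sum_eq_zero_iff_of_nonneg hnn).1 h0 i (Finset.mem_univ i))).resolve_left
      (hl i).ne'
  have hconst : ∀ y ∈ (minkowskiComb A l : Set E), ∀ z ∈ (minkowskiComb A l : Set E),
      inner ℝ y v = inner ℝ z v := by
    intro y hy z hz'
    obtain ⟨a, ha, rfl⟩ := mem_minkowskiComb.1 hy
    obtain ⟨b, hb, rfl⟩ := mem_minkowskiComb.1 hz'
    simp only [sum_inner, inner_smul_left]
    exact Finset.sum_congr rfl fun i _ => by
      rw [(P i).inner_eq_of_hess_eq_zero x v (hz i) _ (ha i) _ (hb i)]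
  obtain ⟨y, hy⟩ := hfull
  have hlim : Tendsto (fun t : ℝ => y + t • v) (nhdsWithin 0 (Ioi 0)) (nhds y) := by
    have : Continuous fun t : ℝ => y + t • v := by fun_prop
    simpa using (this.tendsto 0).mono_left nhdsWithin_le_nhds
  obtain ⟨t, ht, htpos⟩ := ((hlim.eventually (mem_interior_iff_mem_nhds.1 hy)).and
    self_mem_nhdsWithin).exists
  have := hconst _ ht _ (interior_subset hy)
  rw [inner_add_left, inner_smul_left, add_eq_left] at this
  have h3 := mul_pos (mem_Ioi.1 htpos) (real_inner_self_pos.2 hv)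
  exact h3.ne' this

theorem combGrad_injective {l : ι → ℝ} (hl : ∀ i, 0 < l i)
    (hfull : (interior (minkowskiComb A l : Set E)).Nonempty) :
    Function.Injective (combGrad P l) := by
  intro x y hxy
  by_contra hne
  have hv : x - y ≠ 0 := sub_ne_zero.2 hne
  set v := x - y
  have hline : ∀ t : ℝ, HasDerivAt (fun t : ℝ => y + t • v) v t := fun t => by
    simpa using ((hasDerivAt_id t).smul_const v).const_add y
  have hd : ∀ t : ℝ, HasDerivAt (fun t : ℝ => inner ℝ (combGrad P l (y + t • v)) v)
      (inner ℝ (combHess P l (y + t • v) v) v) t := by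
    intro t
    have h1 := (hasFDerivAt_combGrad P l (y + t • v)).comp_hasDerivAt t (hline t)
    simpa using h1.inner ℝ (hasDerivAt_const t v)
  have hmono : StrictMono fun t : ℝ => inner ℝ (combGrad P l (y + t • v)) v :=
    strictMono_of_hasDerivAt_pos hd fun t => inner_combHess_pos P hl hfull _ hv
  have h01 := hmono zero_lt_one
  simp [v, hxy] at h01

variable [FiniteDimensional ℝ E]

theorem interior_subset_range_combGrad {l : ι → ℝ} (hl : ∀ i, 0 < l i) :
    interior (minkowskiComb A l : Set E) ⊆ range (combGrad P l) := by
  intro y hy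
  obtain ⟨ε, hε, hball⟩ := Metric.nhds_basis_closedBall.mem_iff.1 (mem_interior_iff_mem_nhds.1 hy)
  have hL : 0 ≤ ∑ i, l i := Finset.sum_nonneg fun i _ => (hl i).le
  set δ := ε / (2 * (∑ i, l i + 1)) with hδ
  have hδpos : 0 < δ := by positivity
  choose C hC using fun i => (P i).le_pot δ hδpos
  set φ : E → ℝ := fun x => ∑ i, l i * (P i).pot x - inner ℝ x y with hφ
  have hφd : ∀ x, HasFDerivAt φ (innerSL ℝ (combGrad P l x) - innerSL ℝ y) x := by
    intro x
    refine HasFDerivAt.sub ?_ (by simpa [real_inner_comm] using (innerSL ℝ y).hasFDerivAt (x := x))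
    have := HasFDerivAt.fun_sum (u := Finset.univ) fun i _ =>
      ((P i).hasFDerivAt_pot x).const_mul (l i)
    convert this using 1
    simp [combGrad]
  have hbound : ∀ x, ε / 2 * ‖x‖ - ∑ i, l i * C i ≤ φ x := by
    intro x
    have hz : y + (ε / ‖x‖) • x ∈ (minkowskiComb A l : Set E) := by
      apply hball
      rw [mem_closedBall_iff_norm, add_sub_cancel_left, norm_smul, norm_div, norm_norm,
        Real.norm_of_nonneg hε.le]
      rcases eq_or_ne ‖x‖ 0 with h | h
      · simp [h, hε.le]
      · rw [div_mul_cancel₀ _ h]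
    obtain ⟨a, ha, hsum⟩ := mem_minkowskiComb.1 hz
    have h1 : inner ℝ x y + ε * ‖x‖ = ∑ i, l i * inner ℝ x (a i) := by
      have : ∑ i, l i * inner ℝ x (a i) = inner ℝ x (∑ i, l i • a i) := by
        simp [inner_sum, inner_smul_right]
      rw [this, hsum, inner_add_right, inner_smul_right, real_inner_self_eq_norm_sq]
      rcases eq_or_ne ‖x‖ 0 with h | h
      · simp [h]
      · field_simp
    have h2 : ∑ i, l i * (inner ℝ x (a i) - δ * ‖x‖ - C i) ≤ ∑ i, l i * (P i).pot x :=
      Finset.sum_le_sum fun i _ => mul_le_mul_of_nonneg_left (hC i x _ (ha i)) (hl i).le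
    have h3 : ∑ i, l i * (inner ℝ x (a i) - δ * ‖x‖ - C i) =
        ∑ i, l i * inner ℝ x (a i) - (∑ i, l i) * (δ * ‖x‖) - ∑ i, l i * C i := by
      simp only [mul_sub, Finset.sum_sub_distrib, Finset.sum_mul]
    have h4 : (∑ i, l i) * δ ≤ ε / 2 := by
      rw [hδ, mul_div_assoc', div_le_div_iff₀ (by positivity) (by positivity)]
      nlinarith
    have h5 := mul_le_mul_of_nonneg_right h4 (norm_nonneg x)
    simp only [hφ]
    nlinarith
  have hco : Tendsto φ (cocompact E) atTop := by
    refine tendsto_atTop_mono hbound ?_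
    exact tendsto_atTop_add_const_right _ _
      (tendsto_norm_cocompact_atTop.const_mul_atTop (half_pos hε))
  have hcont : Continuous φ :=
    continuous_iff_continuousAt.2 fun x => (hφd x).continuousAt
  obtain ⟨x, hx⟩ := hcont.exists_forall_le hco
  have h0 := IsLocalMin.hasFDerivAt_eq_zero (Eventually.of_forall hx) (hφd x)
  refine ⟨x, ?_⟩
  rw [sub_eq_zero] at h0
  exact (innerSL_inj).1 h0

theorem ContinuousLinearMap.det_pos_of_inner_pos {L : E →L[ℝ] E}
    (hL : ∀ v ≠ 0, 0 < inner ℝ (L v) v) : 0 < L.det := by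
  by_contra! hle
  set p : ℝ → E →L[ℝ] E := fun t => (1 - t) • ContinuousLinearMap.id ℝ E + t • L with hp
  have hc : ContinuousOn (fun t => (p t).det) (Icc 0 1) := by
    refine (ContinuousLinearMap.continuous_det.comp ?_).continuousOn
    fun_prop
  have h0 : (p 0).det = 1 := by simp [hp, ContinuousLinearMap.det]
  have h1 : (p 1).det = L.det := by simp [hp]
  obtain ⟨t, ht, hdet⟩ := intermediate_value_Icc' zero_le_one hc
    (show (0 : ℝ) ∈ Icc (p 1).det (p 0).det by rw [h0, h1]; exact ⟨hle, zero_le_one⟩)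
  obtain ⟨v, hv, hv0⟩ := (Submodule.ne_bot_iff _).1
    (LinearMap.bot_lt_ker_of_det_eq_zero (f := (p t : E →ₗ[ℝ] E)) hdet).ne'
  have hz : inner ℝ (p t v) v = 0 := by
    have : p t v = 0 := hv
    rw [this, inner_zero_left]
  have hexp : inner ℝ (p t v) v = (1 - t) * inner ℝ v v + t * inner ℝ (L v) v := by
    simp [hp, inner_add_left, inner_smul_left]
  have hvv := real_inner_self_pos.2 hv0
  have hLv := hL v hv0
  rw [hexp] at hz
  rcases eq_or_lt_of_le ht.1 with h | h
  · rw [← h] at hz; simp at hz; exact hv0 hz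
  · nlinarith [mul_pos h hLv, mul_nonneg (sub_nonneg.2 ht.2) hvv.le]

variable [MeasurableSpace E] [BorelSpace E]

theorem image_combGrad_ae_eq {l : ι → ℝ} (hl : ∀ i, 0 < l i) :
    combGrad P l '' univ =ᵐ[volume] (minkowskiComb A l : Set E) := by
  rw [image_univ]
  refine (LE.le.eventuallyLE ?_).antisymm ?_
  · rintro _ ⟨x, rfl⟩; exact combGrad_mem P l x
  · have hnull := (minkowskiComb A l).convex.addHaar_frontier volume
    have h := (minkowskiComb A l).isClosed
    filter_upwards [compl_mem_ae_iff.2 hnull] with y hy hyS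
    refine interior_subset_range_combGrad P hl ?_
    by_contra hyi
    exact hy (by rw [h.frontier_eq]; exact ⟨hyS, hyi⟩)

theorem integrable_det_combHess {l : ι → ℝ} (hl : ∀ i, 0 < l i)
    (hfull : (interior (minkowskiComb A l : Set E)).Nonempty) :
    Integrable (fun x => (combHess P l x).det) := by
  have hS : IntegrableOn (fun _ : E => (1 : ℝ)) (minkowskiComb A l : Set E) :=
    integrableOn_const (minkowskiComb A l).isCompact.measure_lt_top.ne
  have := (integrableOn_image_iff_integrableOn_abs_det_fderiv_smul volume MeasurableSet.univ
    (fun x _ => (hasFDerivAt_combGrad P l x).hasFDerivWithinAt)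
    (combGrad_injective P hl hfull).injOn (fun _ => (1 : ℝ))).1
    (hS.congr_set_ae (image_combGrad_ae_eq P hl))
  rw [integrableOn_univ] at this
  refine this.congr (ae_of_all _ fun x => ?_)
  simp [abs_of_pos (ContinuousLinearMap.det_pos_of_inner_pos fun v hv =>
    inner_combHess_pos P hl hfull x hv)]

theorem setIntegral_minkowskiComb_eq {F : Type*} [NormedAddCommGroup F] [NormedSpace ℝ F]
    {l : ι → ℝ} (hl : ∀ i, 0 < l i) (hfull : (interior (minkowskiComb A l : Set E)).Nonempty)
    (f : E → F) : ∫ y in (minkowskiComb A l : Set E), f y =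
      ∫ x, (combHess P l x).det • f (combGrad P l x) := by
  rw [← setIntegral_congr_set (image_combGrad_ae_eq P hl),
    integral_image_eq_integral_abs_det_fderiv_smul volume MeasurableSet.univ
    (fun x _ => (hasFDerivAt_combGrad P l x).hasFDerivWithinAt)
    (combGrad_injective P hl hfull).injOn f, Measure.restrict_univ]
  refine integral_congr_ae (ae_of_all _ fun x => ?_)
  simp [abs_of_pos (ContinuousLinearMap.det_pos_of_inner_pos fun v hv =>
    inner_combHess_pos P hl hfull x hv)]

end MinkowskiCombination

section Expansion

/-- If the values of a random polynomial at all points of the open positive orthant are integrable,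
then so are its coefficients. -/
theorem integrable_coeff_of_integrable_eval {X ι : Type*} [MeasurableSpace X] {μ : Measure X}
    [Fintype ι] (S : Finset (ι →₀ ℕ)) (D : (ι →₀ ℕ) → X → ℝ)
    (h : ∀ l : ι → ℝ, (∀ i, 0 < l i) →
      Integrable (fun x => ∑ α ∈ S, (∏ i, l i ^ α i) * D α x) μ) :
    ∀ α ∈ S, Integrable (D α) μ := by
  classical
  set d : X → S → ℝ := fun x α => D α x
  let ev : (ι → ℝ) → (S → ℝ) →ₗ[ℝ] ℝ := fun l =>
    ∑ α : S, (∏ i, l i ^ (α : ι →₀ ℕ) i) • LinearMap.proj α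
  have hev : ∀ l z, ev l z = ∑ α : S, (∏ i, l i ^ (α : ι →₀ ℕ) i) * z α := fun l z => by
    simp [ev]
  let W : Submodule ℝ ((S → ℝ) →ₗ[ℝ] ℝ) :=
    { carrier := {φ | Integrable (fun x => φ (d x)) μ}
      add_mem' := fun hφ hψ => hφ.add hψ
      zero_mem' := integrable_zero _ _ _
      smul_mem' := fun c _ hφ => hφ.smul c }
  have hspan : Submodule.span ℝ (ev '' {l | ∀ i, 0 < l i}) = ⊤ := by
    refine Submodule.span_eq_top_of_ne_zero fun z hz => ?_
    by_contra! hzero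
    refine hz ?_
    let p : MvPolynomial ι ℝ := ∑ α : S, MvPolynomial.monomial (α : ι →₀ ℕ) (z α)
    have hp : p = 0 := by
      refine MvPolynomial.funext_set (fun _ : ι => Ioi (0 : ℝ)) (fun _ => Ioi_infinite 0)
        fun l hl => ?_
      have := hzero (ev l) ⟨l, fun i => hl i (mem_univ i), rfl⟩
      rw [hev] at this
      simp only [p, map_sum, MvPolynomial.eval_monomial, map_zero]
      rw [← this]
      refine Finset.sum_congr rfl fun α _ => ?_
      rw [mul_comm, Finsupp.prod_fintype _ _ fun i => pow_zero _]
    funext β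
    have hc : MvPolynomial.coeff (β : ι →₀ ℕ) p = z β := by
      simp only [p, MvPolynomial.coeff_sum, MvPolynomial.coeff_monomial]
      rw [Finset.sum_eq_single β]
      · simp
      · intro α _ hα; simp [Subtype.coe_injective.ne hα]
      · simp
    rw [← hc, hp]; simp
  have hW : W = ⊤ := by
    rw [eq_top_iff, ← hspan, Submodule.span_le]
    rintro _ ⟨l, hl, rfl⟩
    refine (h l hl).congr (ae_of_all _ fun x => ?_)
    simp only [hev, d]
    rw [← Finset.sum_coe_sort S]
  intro α hα
  have : LinearMap.proj (R := ℝ) (φ := fun _ : S => ℝ) ⟨α, hα⟩ ∈ W := hW ▸ Submodule.mem_top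
  exact this

variable {E ι : Type*} [Fintype ι]

open Module in
/-- The determinant of a linear combination of endomorphisms is a homogeneous polynomial in the
coefficients. -/
theorem exists_mvPolynomial_eval_eq_det [NormedAddCommGroup E] [NormedSpace ℝ E]
    [FiniteDimensional ℝ E] (H : ι → E →L[ℝ] E) :
    ∃ p : MvPolynomial ι ℝ, p.IsHomogeneous (finrank ℝ E) ∧
      ∀ l : ι → ℝ, MvPolynomial.eval l p = (∑ i, l i • H i).det := by
  classical
  let b := finBasis ℝ E
  let M : ι → Matrix (Fin (finrank ℝ E)) (Fin (finrank ℝ E)) ℝ := fun i =>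
    LinearMap.toMatrix b b (H i)
  let Q : Matrix (Fin (finrank ℝ E)) (Fin (finrank ℝ E)) (MvPolynomial ι ℝ) :=
    Matrix.of fun j k => ∑ i, MvPolynomial.X i * MvPolynomial.C (M i j k)
  refine ⟨Q.det, ?_, fun l => ?_⟩
  · rw [Matrix.det_apply]
    refine MvPolynomial.IsHomogeneous.sum _ _ _ fun σ _ => ?_
    have h : MvPolynomial.IsHomogeneous (∏ j, Q (σ j) j) (∑ _j : Fin (finrank ℝ E), 1) := by
      refine MvPolynomial.IsHomogeneous.prod _ _ _ fun j _ => ?_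
      refine MvPolynomial.IsHomogeneous.sum _ _ _ fun i _ => ?_
      exact (MvPolynomial.isHomogeneous_X _ _).mul (MvPolynomial.isHomogeneous_C _ _)
    simp only [Finset.sum_const, Finset.card_univ, Fintype.card_fin, smul_eq_mul, mul_one] at h
    rcases Int.units_eq_one_or (Equiv.Perm.sign σ) with hs | hs
    · simpa [hs] using h
    · simpa [hs] using h.neg
  · rw [RingHom.map_det, ContinuousLinearMap.det, ← LinearMap.det_toMatrix b]
    congr 1
    ext j k
    simp [Q, M, Matrix.sum_apply, map_sum]

/-- The monomials of degree `n`. -/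
def monomialsOfDegree (ι : Type*) [Fintype ι] (n : ℕ) : Finset (ι →₀ ℕ) :=
  open Classical in Finset.finsuppAntidiag Finset.univ n

theorem mem_monomialsOfDegree {n : ℕ} {α : ι →₀ ℕ} :
    α ∈ monomialsOfDegree ι n ↔ ∑ i, α i = n := by
  simp [monomialsOfDegree, Finset.mem_finsuppAntidiag]

theorem MvPolynomial.IsHomogeneous.eval_eq_sum_monomialsOfDegree {p : MvPolynomial ι ℝ} {n : ℕ}
    (hp : p.IsHomogeneous n) (l : ι → ℝ) :
    MvPolynomial.eval l p = ∑ α ∈ monomialsOfDegree ι n, (∏ i, l i ^ α i) * p.coeff α := by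
  rw [MvPolynomial.eval_eq']
  simp_rw [mul_comm]
  refine Finset.sum_subset (fun α hα => ?_) fun α _ hα => ?_
  · rw [mem_monomialsOfDegree]
    by_contra hne
    refine MvPolynomial.mem_support_iff.1 hα (hp.coeff_eq_zero ?_)
    rwa [Finsupp.degree_eq_sum]
  · simp [MvPolynomial.notMem_support_iff.1 hα]

variable [NormedAddCommGroup E] [InnerProductSpace ℝ E] [FiniteDimensional ℝ E]
  [MeasurableSpace E] [BorelSpace E] {A : ι → ConvexBody E}
  (P : ∀ i, GradientPotential (A i : Set E))

open Module

theorem exists_integrable_coeff_det_combHess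
    (hfull : ∀ l : ι → ℝ, (∀ i, 0 < l i) → (interior (minkowskiComb A l : Set E)).Nonempty) :
    ∃ D : (ι →₀ ℕ) → E → ℝ, (∀ α ∈ monomialsOfDegree ι (finrank ℝ E), Integrable (D α)) ∧
      ∀ l x, (combHess P l x).det =
        ∑ α ∈ monomialsOfDegree ι (finrank ℝ E), (∏ i, l i ^ α i) * D α x := by
  choose p hp hpe using fun x => exists_mvPolynomial_eval_eq_det fun i => (P i).hess x
  have hdet : ∀ l x, (combHess P l x).det =
      ∑ α ∈ monomialsOfDegree ι (finrank ℝ E), (∏ i, l i ^ α i) * (p x).coeff α := fun l x => by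
    rw [combHess, ← hpe, (hp x).eval_eq_sum_monomialsOfDegree]
  refine ⟨fun α x => (p x).coeff α, ?_, hdet⟩
  refine integrable_coeff_of_integrable_eval _ _ fun l hl => ?_
  simpa only [hdet] using integrable_det_combHess P hl (hfull l hl)

/-- Continuity of the integral over a Minkowski combination, from above. -/
theorem tendsto_setIntegral_minkowskiComb {F : Type*} [NormedAddCommGroup F] [NormedSpace ℝ F]
    (A : ι → ConvexBody E) {f : E → F} (hf : Continuous f) {l m : ι → ℝ} (hl : 0 ≤ l)
    (hm : 0 ≤ m) :
    Tendsto (fun ε : ℝ => ∫ y in (minkowskiComb A (l + ε • m) : Set E), f y)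
      (nhdsWithin 0 (Ioi 0)) (nhds (∫ y in (minkowskiComb A l : Set E), f y)) := by
  set S := minkowskiComb A l
  set B := minkowskiComb A m
  have hS : ∀ ε : ℝ, 0 ≤ ε →
      (minkowskiComb A (l + ε • m) : Set E) = (S : Set E) + ε • (B : Set E) :=
    fun ε hε => by
      rw [minkowskiComb_add A hl (smul_nonneg hε hm), minkowskiComb_smul, ConvexBody.coe_add,
        ConvexBody.coe_smul]
  obtain ⟨R, hR⟩ := S.isBounded.exists_norm_le
  obtain ⟨Q, hQ⟩ := B.isBounded.exists_norm_le
  have hQ0 : 0 ≤ Q := by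
    obtain ⟨b, hb⟩ := B.nonempty
    exact (norm_nonneg b).trans (hQ b hb)
  have hfi : IntegrableOn f (Metric.closedBall 0 (R + Q)) :=
    hf.continuousOn.integrableOn_compact (isCompact_closedBall _ _)
  have hmeas : ∀ l, MeasurableSet (minkowskiComb A l : Set E) := fun l =>
    (minkowskiComb A l).isClosed.measurableSet
  simp_rw [S, ← integral_indicator (hmeas _)]
  refine tendsto_integral_filter_of_dominated_convergence (l := nhdsWithin 0 (Ioi 0))
    (F := fun ε : ℝ => (minkowskiComb A (l + ε • m) : Set E).indicator f)
    (f := (S : Set E).indicator f)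
    ((Metric.closedBall 0 (R + Q)).indicator fun y => ‖f y‖) ?_ ?_ ?_ ?_
  · exact Eventually.of_forall fun ε =>
      (hf.aestronglyMeasurable.indicator (hmeas _))
  · filter_upwards [Ioo_mem_nhdsGT (zero_lt_one' ℝ)] with ε hε
    refine ae_of_all _ fun y => ?_
    rw [norm_indicator_eq_indicator_norm]
    refine indicator_le_indicator_of_subset ?_ (fun _ => norm_nonneg _) y
    rw [hS ε hε.1.le]
    rintro _ ⟨s, hs, _, ⟨b, hb, rfl⟩, rfl⟩
    rw [mem_closedBall_zero_iff]
    refine (norm_add_le _ _).trans (add_le_add (hR s hs) ?_)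
    simp only [norm_smul, Real.norm_of_nonneg hε.1.le]
    exact (mul_le_of_le_one_left (norm_nonneg _) hε.2.le).trans (hQ b hb)
  · exact (integrable_indicator_iff measurableSet_closedBall).2 hfi.norm
  · filter_upwards [compl_mem_ae_iff.2 (S.convex.addHaar_frontier volume)] with y hy
    refine tendsto_const_nhds.congr' ?_
    by_cases hyS : y ∈ (S : Set E)
    · have hyi : y ∈ interior (S : Set E) := by
        by_contra hyi
        exact hy (by rw [S.isClosed.frontier_eq]; exact ⟨hyS, hyi⟩)
      obtain ⟨b, hb⟩ := B.nonempty
      have hlim : Tendsto (fun ε : ℝ => y - ε • b) (nhdsWithin 0 (Ioi 0)) (nhds y) := by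
        have : Continuous fun ε : ℝ => y - ε • b := by fun_prop
        simpa using (this.tendsto 0).mono_left nhdsWithin_le_nhds
      filter_upwards [hlim.eventually (mem_interior_iff_mem_nhds.1 hyi), self_mem_nhdsWithin]
        with ε hε hpos
      have : y ∈ (minkowskiComb A (l + ε • m) : Set E) := by
        rw [hS ε (mem_Ioi.1 hpos).le]
        exact ⟨y - ε • b, hε, ε • b, smul_mem_smul_set hb, by simp⟩
      rw [indicator_of_mem hyS, indicator_of_mem this]
    · obtain ⟨r, hr, hball⟩ := Metric.isOpen_iff.1 S.isClosed.isOpen_compl y hyS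
      have : ∀ᶠ ε : ℝ in nhdsWithin 0 (Ioi 0), ε * Q < r := by
        have : Continuous fun ε : ℝ => ε * Q := by fun_prop
        have h0 := (this.tendsto 0).mono_left (nhdsWithin_le_nhds (s := Ioi 0))
        rw [zero_mul] at h0
        exact h0.eventually_lt_const hr
      filter_upwards [this, self_mem_nhdsWithin] with ε hε hpos
      have hpos' : 0 < ε := hpos
      have : y ∉ (minkowskiComb A (l + ε • m) : Set E) := by
        rw [hS ε hpos'.le]
        rintro ⟨s, hs, _, ⟨b, hb, rfl⟩, rfl⟩
        refine hball (a := s) ?_ hs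
        rw [mem_ball_iff_norm]
        simp only [sub_add_cancel_left, norm_neg, norm_smul, Real.norm_of_nonneg hpos'.le]
        exact (mul_le_mul_of_nonneg_left (hQ b hb) hpos'.le).trans_lt hε
      rw [indicator_of_notMem hyS, indicator_of_notMem this]

end Expansion

section SmoothExpansion

universe u

open Module

/-- Alesker's theorem: the integral of a smooth function over `∑ i, l i • A i` is, for nonnegative
`l`, the restriction of a function in the `n`-th power of the ideal generated by the coordinates
in the ring of smooth functions, where `n` is the dimension. -/
theorem exists_contDiff_expansion_setIntegral {ι F : Type u} {E : Type*} [Fintype ι]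
    [NormedAddCommGroup E] [InnerProductSpace ℝ E] [FiniteDimensional ℝ E] [MeasurableSpace E]
    [BorelSpace E] [NormedAddCommGroup F] [NormedSpace ℝ F]
    (A : ι → ConvexBody E) {f : E → F} (hf : ContDiff ℝ ∞ f) :
    ∃ G : (ι →₀ ℕ) → (ι → ℝ) → F, (∀ α ∈ monomialsOfDegree ι (finrank ℝ E), ContDiff ℝ ∞ (G α)) ∧
      ∀ l, 0 ≤ l → ∫ y in (minkowskiComb A l : Set E), f y =
        ∑ α ∈ monomialsOfDegree ι (finrank ℝ E), (∏ i, l i ^ α i) • G α l := by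
  by_cases hfull : ∀ l : ι → ℝ, (∀ i, 0 < l i) → (interior (minkowskiComb A l : Set E)).Nonempty
  · have P : ∀ i, GradientPotential (A i : Set E) := fun i =>
      (exists_gradientPotential (A i).convex (A i).isCompact (A i).nonempty).some
    obtain ⟨D, hD, hdet⟩ := exists_integrable_coeff_det_combHess P hfull
    set k : E → ι → E := fun x i => (P i).grad x with hk
    have hkc : Continuous k := continuous_pi fun i =>
      continuous_iff_continuousAt.2 fun x => ((P i).hasFDerivAt_grad x).continuousAt
    obtain ⟨R, hR⟩ : ∃ R, ∀ x, ‖k x‖ ≤ R := by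
      choose r hr using fun i => (A i).isBounded.exists_norm_le
      refine ⟨∑ i, |r i|, fun x => (pi_norm_le_iff_of_nonneg
        (Finset.sum_nonneg fun i _ => abs_nonneg _)).2 fun i => ?_⟩
      exact ((hr i _ ((P i).grad_mem x)).trans (le_abs_self _)).trans
        (Finset.single_le_sum (f := fun i => |r i|) (fun _ _ => abs_nonneg _) (Finset.mem_univ i))
    let Φ : (ι → ℝ) × (ι → E) → F := fun p => f (∑ i, p.1 i • p.2 i)
    have hΦ : ContDiff ℝ ∞ Φ := by
      refine hf.comp (ContDiff.sum fun i _ => ?_)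
      exact ((contDiff_apply ℝ ℝ i).comp contDiff_fst).smul
        ((contDiff_apply ℝ E i).comp contDiff_snd)
    let G : (ι →₀ ℕ) → (ι → ℝ) → F := fun α l => ∫ x, D α x • Φ (l, k x)
    have hG : ∀ α ∈ monomialsOfDegree ι (finrank ℝ E), ContDiff ℝ ∞ (G α) := fun α hα =>
      contDiff_integral_smul_comp_param (hD α hα) hkc.aestronglyMeasurable hR hΦ
    have hpos : ∀ l : ι → ℝ, (∀ i, 0 < l i) → ∫ y in (minkowskiComb A l : Set E), f y =
        ∑ α ∈ monomialsOfDegree ι (finrank ℝ E), (∏ i, l i ^ α i) • G α l := by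
      intro l hl
      rw [setIntegral_minkowskiComb_eq P hl (hfull l hl)]
      simp_rw [hdet, Finset.sum_smul, mul_smul]
      rw [integral_finsetSum]
      · simp_rw [integral_smul]
        rfl
      · intro α hα
        exact (integrable_smul_comp_param (hD α hα) hkc.aestronglyMeasurable hR
          hΦ.continuous l).smul (∏ i, l i ^ α i)
    refine ⟨G, hG, fun l hl => ?_⟩
    refine tendsto_nhds_unique (tendsto_setIntegral_minkowskiComb A hf.continuous hl
      (m := 1) zero_le_one) ?_
    have hc : Continuous fun ε : ℝ => ∑ α ∈ monomialsOfDegree ι (finrank ℝ E),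
        (∏ i, (l + ε • (1 : ι → ℝ)) i ^ α i) • G α (l + ε • (1 : ι → ℝ)) := by
      refine continuous_finsetSum _ fun α hα => ?_
      have := (hG α hα).continuous
      fun_prop
    have h0 := (hc.tendsto 0).mono_left (nhdsWithin_le_nhds (s := Ioi 0))
    simp only [zero_smul, add_zero] at h0
    refine h0.congr' ?_
    filter_upwards [self_mem_nhdsWithin] with ε hε
    refine (hpos _ fun i => ?_).symm
    have : 0 < ε := hε
    have : 0 ≤ l i := hl i
    simp only [Pi.add_apply, Pi.smul_apply, Pi.one_apply, smul_eq_mul, mul_one]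
    positivity
  · push Not at hfull
    obtain ⟨m, hm, hempty⟩ := hfull
    refine ⟨fun _ _ => 0, fun _ _ => contDiff_const, fun l hl => ?_⟩
    simp only [smul_zero, Finset.sum_const_zero]
    have hl0 : interior (minkowskiComb A l : Set E) = ∅ := by
      by_contra hne
      obtain ⟨c, hc, hcm⟩ : ∃ c : ℝ, 0 < c ∧ c • l ≤ m := by
        have : ∀ᶠ c : ℝ in nhdsWithin 0 (Ioi 0), ∀ i, c * l i < m i := by
          refine eventually_all.2 fun i => ?_
          have : Continuous fun c : ℝ => c * l i := by fun_prop
          have h0 := (this.tendsto 0).mono_left (nhdsWithin_le_nhds (s := Ioi 0))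
          rw [zero_mul] at h0
          exact h0.eventually_lt_const (hm i)
        obtain ⟨c, h, hc⟩ := (this.and self_mem_nhdsWithin).exists
        exact ⟨c, hc, fun i => (h i).le⟩
      exact (interior_minkowskiComb_nonempty hl hc hcm (nonempty_iff_ne_empty.2 hne)).ne_empty
        hempty
    have hnull : volume (minkowskiComb A l : Set E) = 0 := by
      have := (minkowskiComb A l).convex.addHaar_frontier volume
      rwa [(minkowskiComb A l).isClosed.frontier_eq, hl0, sdiff_empty] at this
    exact setIntegral_measure_zero _ hnull

end SmoothExpansion

section VanishingOrder

universe u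

/-- A smooth function all of whose derivatives of order `< m` vanish at the origin. -/
structure SmoothVanishing {E F : Type*} [NormedAddCommGroup E] [NormedSpace ℝ E]
    [NormedAddCommGroup F] [NormedSpace ℝ F] (m : ℕ) (H : E → F) : Prop where
  contDiff : ContDiff ℝ ∞ H
  iteratedFDeriv_eq_zero : ∀ j < m, iteratedFDeriv ℝ j H 0 = 0

namespace SmoothVanishing

variable {E F G : Type*} [NormedAddCommGroup E] [NormedSpace ℝ E]
  [NormedAddCommGroup F] [NormedSpace ℝ F] [NormedAddCommGroup G] [NormedSpace ℝ G]
  {m : ℕ} {H : E → F}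

theorem of_contDiff (hH : ContDiff ℝ ∞ H) : SmoothVanishing 0 H :=
  ⟨hH, fun _ h => absurd h (Nat.not_lt_zero _)⟩

theorem mono {k : ℕ} (h : SmoothVanishing m H) (hk : k ≤ m) : SmoothVanishing k H :=
  ⟨h.contDiff, fun j hj => h.iteratedFDeriv_eq_zero j (hj.trans_le hk)⟩

theorem fderiv (h : SmoothVanishing (m + 1) H) : SmoothVanishing m (fderiv ℝ H) :=
  ⟨h.contDiff.fderiv_right (by simp), fun j hj => by
    rw [← norm_eq_zero, norm_iteratedFDeriv_fderiv,
      h.iteratedFDeriv_eq_zero _ (Nat.succ_lt_succ hj), norm_zero]⟩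

theorem of_fderiv (hH : ContDiff ℝ ∞ H) (h0 : H 0 = 0)
    (h : SmoothVanishing m (_root_.fderiv ℝ H)) : SmoothVanishing (m + 1) H :=
  ⟨hH, fun j hj => by
    rw [← norm_eq_zero]
    cases j with
    | zero => rw [norm_iteratedFDeriv_zero, h0, norm_zero]
    | succ j => rw [← norm_iteratedFDeriv_fderiv,
        h.iteratedFDeriv_eq_zero j (Nat.lt_of_succ_lt_succ hj), norm_zero]⟩

theorem add {H' : E → F} (h : SmoothVanishing m H) (h' : SmoothVanishing m H') :
    SmoothVanishing m (fun x => H x + H' x) :=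
  ⟨h.contDiff.add h'.contDiff, fun j hj => by
    have := iteratedFDeriv_add_apply (x := (0 : E))
      (h.contDiff.of_le (m := j) (mod_cast le_top)).contDiffAt
      (h'.contDiff.of_le (m := j) (mod_cast le_top)).contDiffAt
    rw [h.iteratedFDeriv_eq_zero j hj, h'.iteratedFDeriv_eq_zero j hj, add_zero] at this
    exact this⟩

theorem zero : SmoothVanishing m (fun _ : E => (0 : F)) :=
  ⟨contDiff_const, fun j _ => by simp⟩

theorem sum {κ : Type*} (s : Finset κ) {H : κ → E → F} (h : ∀ i ∈ s, SmoothVanishing m (H i)) :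
    SmoothVanishing m (fun x => ∑ i ∈ s, H i x) := by
  classical
  induction s using Finset.induction_on with
  | empty => simpa using zero
  | insert i s hi ih =>
    simp only [Finset.sum_insert hi]
    exact (h i (Finset.mem_insert_self i s)).add
      (ih fun j hj => h j (Finset.mem_insert_of_mem hj))

theorem clm_comp (L : F →L[ℝ] G) (h : SmoothVanishing m H) :
    SmoothVanishing m (fun x => L (H x)) :=
  ⟨L.contDiff.comp h.contDiff, fun j hj => by
    have := L.iteratedFDeriv_comp_left (x := (0 : E)) (i := j) h.contDiff.contDiffAt
      (mod_cast le_top)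
    rw [h.iteratedFDeriv_eq_zero j hj] at this
    exact this.trans (by ext; simp)⟩

theorem comp_clm {H : F → G} (h : SmoothVanishing m H) (L : E →L[ℝ] F) :
    SmoothVanishing m (fun x => H (L x)) :=
  ⟨h.contDiff.comp L.contDiff, fun j hj => by
    have := L.iteratedFDeriv_comp_right (f := H) (i := j) h.contDiff 0 (mod_cast le_top)
    rw [map_zero, h.iteratedFDeriv_eq_zero j hj] at this
    exact this.trans (by ext; simp)⟩

theorem clm_smul {E F : Type u} [NormedAddCommGroup E] [NormedSpace ℝ E]
    [NormedAddCommGroup F] [NormedSpace ℝ F] (L : E →L[ℝ] ℝ) {m : ℕ} {H : E → F}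
    (h : SmoothVanishing m H) : SmoothVanishing (m + 1) (fun x => L x • H x) := by
  induction m generalizing F with
  | zero =>
    refine of_fderiv (L.contDiff.smul h.contDiff) (by simp) (of_contDiff ?_)
    exact (L.contDiff.smul h.contDiff).fderiv_right (by simp)
  | succ m ih =>
    refine of_fderiv (L.contDiff.smul h.contDiff) (by simp) ?_
    have hd : _root_.fderiv ℝ (fun x => L x • H x) = fun x =>
        L x • _root_.fderiv ℝ H x + ContinuousLinearMap.smulRightL ℝ E F L (H x) := by
      funext x
      exact (L.hasFDerivAt.smul
        (h.contDiff.differentiable (by simp) x).hasFDerivAt).fderiv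
    rw [hd]
    exact (ih h.fderiv).add (h.clm_comp _)

theorem monomial_smul {ι F : Type u} [Fintype ι] [NormedAddCommGroup F] [NormedSpace ℝ F]
    {H : (ι → ℝ) → F} (hH : ContDiff ℝ ∞ H) (α : ι → ℕ) :
    SmoothVanishing (∑ i, α i) (fun l : ι → ℝ => (∏ i, l i ^ α i) • H l) := by
  classical
  have hpow : ∀ (i : ι) (k m : ℕ) (H : (ι → ℝ) → F), SmoothVanishing m H →
      SmoothVanishing (k + m) (fun l : ι → ℝ => l i ^ k • H l) := by
    intro i k
    induction k with
    | zero => intro m H h; simpa using h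
    | succ k ih =>
      intro m H h
      have := clm_smul (ContinuousLinearMap.proj (R := ℝ) (φ := fun _ : ι => ℝ) i) (ih m H h)
      rw [add_right_comm]
      simpa [smul_smul, pow_succ'] using this
  induction (Finset.univ : Finset ι) using Finset.induction_on with
  | empty => simpa using of_contDiff hH
  | insert i s hi ih =>
    simp only [Finset.sum_insert hi, Finset.prod_insert hi, mul_smul]
    exact hpow i _ _ _ ih

theorem iteratedDeriv_eq_zero {v : ℝ → F} (h : SmoothVanishing m v) {k : ℕ} (hk : k < m) :
    iteratedDeriv k v 0 = 0 := by
  rw [iteratedDeriv, h.iteratedFDeriv_eq_zero k hk]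
  simp

end SmoothVanishing

end VanishingOrder

section MixedPartial

variable {s : ℕ} {F : Type} [NormedAddCommGroup F] [NormedSpace ℝ F]

/-- The point of `ℝ × ℝ^s` with coordinates `t` and `lam`. -/
def optionVec (t : ℝ) (lam : Fin s → ℝ) : Option (Fin s) → ℝ := fun o => o.elim t lam

theorem optionVec_update (t : ℝ) (lam : Fin s → ℝ) (i : Fin s) (τ : ℝ) :
    optionVec t (Function.update lam i τ) = Function.update (optionVec t lam) (some i) τ := by
  funext o
  cases o with
  | none => simp [optionVec]
  | some j =>
    rcases eq_or_ne j i with rfl | h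
    · simp [optionVec]
    · simp [optionVec, h]

theorem pderivOrth_eq_of_eqOn {g : (Fin s → ℝ) → F} {H : (Option (Fin s) → ℝ) → F}
    (hH : Differentiable ℝ H) {t : ℝ} (hg : ∀ lam, 0 ≤ lam → g lam = H (optionVec t lam))
    (i : Fin s) {lam : Fin s → ℝ} (hlam : 0 ≤ lam) :
    pderivOrth g i lam = fderiv ℝ H (optionVec t lam) (Pi.single (some i) 1) := by
  have hup : ∀ τ ∈ Ici (0 : ℝ), g (Function.update lam i τ) =
      H (Function.update (optionVec t lam) (some i) τ) := fun τ hτ => by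
    rw [hg, optionVec_update]
    exact le_update_iff.2 ⟨hτ, fun j _ => hlam j⟩
  have hd : HasDerivAt (fun τ => H (Function.update (optionVec t lam) (some i) τ))
      (fderiv ℝ H (optionVec t lam) (Pi.single (some i) 1)) (lam i) := by
    refine HasFDerivAt.comp_hasDerivAt (lam i) ?_ (hasDerivAt_update _ _ _)
    have : Function.update (optionVec t lam) (some i) (lam i) = optionVec t lam := by
      rw [← optionVec_update, Function.update_eq_self]
    rw [this]
    exact (hH _).hasFDerivAt
  exact (hd.hasDerivWithinAt.congr hup (hup _ (hlam i))).derivWithin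
    (uniqueDiffOn_Ici 0 _ (hlam i))

theorem exists_foldl_pderivOrth_eq (L : List (Fin s)) {m : ℕ} {g : ℝ → (Fin s → ℝ) → F}
    {H : (Option (Fin s) → ℝ) → F} (hH : SmoothVanishing (m + L.length) H)
    (hg : ∀ t, 0 ≤ t → ∀ lam, 0 ≤ lam → g t lam = H (optionVec t lam)) :
    ∃ H' : (Option (Fin s) → ℝ) → F, SmoothVanishing m H' ∧
      ∀ t, 0 ≤ t → ∀ lam, 0 ≤ lam →
        List.foldl pderivOrth (g t) L lam = H' (optionVec t lam) := by
  induction L generalizing g H with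
  | nil => exact ⟨H, by simpa using hH, hg⟩
  | cons i L ih =>
    simp only [List.foldl_cons]
    refine ih (g := fun t => pderivOrth (g t) i)
      (H := fun l => fderiv ℝ H l (Pi.single (some i) 1)) ?_ fun t ht lam hlam => ?_
    · exact (SmoothVanishing.fderiv (m := m + L.length) (by simpa [add_assoc] using hH)).clm_comp
        (ContinuousLinearMap.apply ℝ F (Pi.single (some i) (1 : ℝ)))
    · exact pderivOrth_eq_of_eqOn (hH.contDiff.differentiable (by simp)) (hg t ht) i hlam

theorem exists_mixedPartialAtZero_eq {m : ℕ} {g : ℝ → (Fin s → ℝ) → F}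
    {H : (Option (Fin s) → ℝ) → F} (hH : SmoothVanishing (m + s) H)
    (hg : ∀ t, 0 ≤ t → ∀ lam, 0 ≤ lam → g t lam = H (optionVec t lam)) :
    ∃ v : ℝ → F, SmoothVanishing m v ∧ ∀ t, 0 ≤ t → mixedPartialAtZero (g t) = v t := by
  obtain ⟨H', hH', h⟩ := exists_foldl_pderivOrth_eq (List.finRange s) (m := m)
    (by simpa using hH) hg
  refine ⟨_, hH'.comp_clm ((ContinuousLinearMap.id ℝ ℝ).smulRight
    (Pi.single none 1 : Option (Fin s) → ℝ)), fun t ht => ?_⟩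
  rw [mixedPartialAtZero, h t ht 0 le_rfl]
  congr 1
  funext o
  cases o <;> simp [optionVec]

theorem setIntegral_scaleTrans_add {n : ℕ} (A : Fin s → ConvexBody (Euc n)) (K : ConvexBody (Euc n))
    (x : Euc n) (f : Euc n → F) (t : ℝ) (lam : Fin s → ℝ) :
    ∫ y in ((scaleTrans t x K : Set (Euc n)) + ∑ i, lam i • (A i : Set (Euc n))), f y =
      ∫ y in (minkowskiComb (fun o : Option (Fin s) => o.elim K A) (optionVec t lam) :
        Set (Euc n)), f (y + x) := by
  rw [← (measurePreserving_add_right volume x).setIntegral_preimage_emb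
    (measurableEmbedding_addRight x)]
  congr 2
  have h : (scaleTrans t x K : Set (Euc n)) + ∑ i, lam i • (A i : Set (Euc n)) =
      (minkowskiComb (fun o : Option (Fin s) => o.elim K A) (optionVec t lam) : Set (Euc n)) +
        {x} := by
    rw [coe_minkowskiComb, Fintype.sum_option]
    change (t • (K : Set (Euc n)) + {x}) + _ = t • (K : Set (Euc n)) + _ + _
    rw [add_right_comm]
    rfl
  rw [h]
  ext y
  simp

end MixedPartial

/-- For `φ(K) = ∂^s/∂λ |₀ ∫_{K + Σ λᵢAᵢ} f`, the function `u(t) = φ(tK + x)` is `C^∞` on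
`[0,1]` and its derivatives at `0` of order `< n - s` vanish. -/
theorem mixed_derivative_valuation_in_W {n : ℕ} (hn : 1 ≤ n)
    (s : ℕ) (hs : s ≤ n) (f : Euc n → ℂ) (hf : ContDiff ℝ ∞ f)
    (A : Fin s → ConvexBody (Euc n)) (K : ConvexBody (Euc n)) (x : Euc n) :
    ContDiffOn ℝ ∞
      (fun t : ℝ => mixedPartialAtZero (fun lam : Fin s → ℝ =>
        ∫ y in ((scaleTrans t x K : Set (Euc n)) + ∑ i, lam i • (A i : Set (Euc n))), f y))
      (Set.Icc 0 1) ∧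
    ∀ k < n - s,
      iteratedDerivWithin k
        (fun t : ℝ => mixedPartialAtZero (fun lam : Fin s → ℝ =>
          ∫ y in ((scaleTrans t x K : Set (Euc n)) + ∑ i, lam i • (A i : Set (Euc n))), f y))
        (Set.Icc 0 1) 0 = 0 := by
  obtain ⟨G, hG, hfull⟩ := exists_contDiff_expansion_setIntegral
    (fun o : Option (Fin s) => o.elim K A) (f := fun y => f (y + x))
    (hf.comp (contDiff_id.add contDiff_const))
  have hH : SmoothVanishing n (fun l : Option (Fin s) → ℝ =>
      ∑ α ∈ monomialsOfDegree (Option (Fin s)) (Module.finrank ℝ (Euc n)),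
        (∏ i, l i ^ α i) • G α l) := SmoothVanishing.sum _ fun α hα => by
    have h := SmoothVanishing.monomial_smul (hG α hα) α
    rwa [mem_monomialsOfDegree.1 hα, finrank_euclideanSpace_fin] at h
  obtain ⟨v, hv, huv⟩ := exists_mixedPartialAtZero_eq (m := n - s)
    (hH.mono (Nat.sub_add_cancel hs).le)
    (g := fun t lam =>
      ∫ y in ((scaleTrans t x K : Set (Euc n)) + ∑ i, lam i • (A i : Set (Euc n))), f y)
    fun t ht lam hlam => by
      rw [setIntegral_scaleTrans_add, hfull]
      rintro (_ | i)
      exacts [ht, hlam i]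
  have heq : EqOn _ v (Icc 0 1) := fun t ht => huv t ht.1
  refine ⟨hv.contDiff.contDiffOn.congr heq, fun k hk => ?_⟩
  have h0 : (0 : ℝ) ∈ Icc (0 : ℝ) 1 := ⟨le_rfl, zero_le_one⟩
  rw [iteratedDerivWithin_congr heq h0, iteratedDerivWithin_eq_iteratedDeriv
    (uniqueDiffOn_Icc zero_lt_one) (hv.contDiff.of_le (mod_cast le_top)).contDiffAt h0]
  exact hv.iteratedDeriv_eq_zero hk
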